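/- LB_New is a lower bound: for L ≥ 2 and any window size W ≥ 0, δ(A_1,B_1) + δ(A_L,B_L) + Σ_{i=2}^{L−1} min{ δ(A_i,B_j) : max(1,i−W) ≤ j ≤ min(L,i+W) } ≤ DTW²_W(A,B). -/

import Mathlib

noncomputable section

/-- Squared pointwise cost. -/
def delta (x y : ℝ) : ℝ := (x - y) ^ 2

/-- Continuity/monotonicity step of a warping path. -/
def Step (q r : ℕ × ℕ) : Prop :=
  r = (q.1 + 1, q.2) ∨ r = (q.1, q.2 + 1) ∨ r = (q.1 + 1, q.2 + 1)

/-- A `W`-warping path for series of length `L` (1-based indices). -/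
def IsWarpingPath (L W : ℕ) (p : List (ℕ × ℕ)) : Prop :=
  p.head? = some (1, 1) ∧ p.getLast? = some (L, L) ∧ List.Chain' Step p ∧
    ∀ q ∈ p, 1 ≤ q.1 ∧ q.1 ≤ L ∧ 1 ≤ q.2 ∧ q.2 ≤ L ∧ ((q.1 : ℤ) - (q.2 : ℤ)).natAbs ≤ W

/-- Cost of a warping path. -/
def pathCost (A B : ℕ → ℝ) (p : List (ℕ × ℕ)) : ℝ :=
  (p.map (fun q => delta (A q.1) (B q.2))).sum

/-- `DTW²_W(A,B)`: minimum cost over all `W`-warping paths. -/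
def DTW2 (L W : ℕ) (A B : ℕ → ℝ) : ℝ :=
  sInf (pathCost A B '' {p | IsWarpingPath L W p})

/-- Left band `ℒ^W_i`. -/
def leftBand (W i : ℕ) : Finset (ℕ × ℕ) :=
  (Finset.Icc (max 1 (i - W)) i).image (fun j => (j, i)) ∪
    (Finset.Icc (max 1 (i - W)) i).image (fun k => (i, k))

/-- Right band `ℛ^W_i`. -/
def rightBand (L W i : ℕ) : Finset (ℕ × ℕ) :=
  (Finset.Icc i (min L (i + W))).image (fun j => (j, i)) ∪
    (Finset.Icc i (min L (i + W))).image (fun k => (i, k))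

/-- Vertical band `𝒱_i`. -/
def vertBand (L W i : ℕ) : Finset (ℕ × ℕ) :=
  (Finset.Icc (max 1 (i - W)) (min L (i + W))).image (fun j => (i, j))

/-- Minimum of `δ(A_j, B_k)` over a (finite, nonempty) band of pairs `(j,k)`. -/
def bandMin (A B : ℕ → ℝ) (s : Finset (ℕ × ℕ)) : ℝ :=
  sInf ((fun q => delta (A q.1) (B q.2)) '' (s : Set (ℕ × ℕ)))

/-- Upper envelope `𝕌^B_i`. -/
def upperEnv (L W : ℕ) (B : ℕ → ℝ) (i : ℕ) : ℝ :=
  sSup (B '' Set.Icc (max 1 (i - W)) (min L (i + W)))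

/-- Lower envelope `𝕃^B_i`. -/
def lowerEnv (L W : ℕ) (B : ℕ → ℝ) (i : ℕ) : ℝ :=
  sInf (B '' Set.Icc (max 1 (i - W)) (min L (i + W)))

/-- LB_Keogh term `κ_i`. -/
def kappa (L W : ℕ) (A B : ℕ → ℝ) (i : ℕ) : ℝ :=
  if upperEnv L W B i < A i then delta (A i) (upperEnv L W B i)
  else if A i < lowerEnv L W B i then delta (A i) (lowerEnv L W B i)
  else 0

theorem delta_nonneg (x y : ℝ) : 0 ≤ delta x y := sq_nonneg _

/-- A list of lattice points linked by `Step` visits every intermediate first coordinate. -/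
theorem exists_mem_fst_eq_of_isChain_step (l : List (ℕ × ℕ)) :
    ∀ a b : ℕ × ℕ, List.IsChain Step (a :: l) → (a :: l).getLast? = some b →
      ∀ i, a.1 ≤ i → i ≤ b.1 → ∃ q ∈ a :: l, q.1 = i := by
  induction l with
  | nil =>
    intro a b _ hlast i hai hib
    obtain rfl : a = b := by simpa using hlast
    exact ⟨a, by simp, le_antisymm hai hib⟩
  | cons c l ih =>
    intro a b hchain hlast i hai hib
    rw [List.isChain_cons_cons] at hchain
    rw [List.getLast?_cons_cons] at hlast
    rcases hai.eq_or_lt with h | h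
    · exact ⟨a, by simp, h⟩
    · have hci : c.1 ≤ i := by
        rcases hchain.1 with h' | h' | h' <;> rw [h'] <;> simp only <;> omega
      obtain ⟨q, hq, hqi⟩ := ih c b hchain.2 hlast i hci hib
      exact ⟨q, List.mem_cons_of_mem _ hq, hqi⟩

/-- The diagonal is a warping path. -/
theorem exists_isWarpingPath (W n : ℕ) : ∃ p, IsWarpingPath (n + 1) W p := by
  induction n with
  | zero => exact ⟨[(1, 1)], rfl, rfl, List.isChain_singleton _, by simp⟩
  | succ n ih =>
    obtain ⟨p, hhead, hlast, hchain, hmem⟩ := ih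
    refine ⟨p ++ [(n + 2, n + 2)], ?_, by simp, ?_, ?_⟩
    · simp [List.head?_append, hhead]
    · refine List.IsChain.append hchain (by simp) ?_
      intro x hx y hy
      rw [hlast] at hx
      obtain rfl : (n + 1, n + 1) = x := by simpa using hx
      obtain rfl : (n + 2, n + 2) = y := by simpa using hy
      exact Or.inr (Or.inr rfl)
    · intro q hq
      rcases List.mem_append.1 hq with hq | hq
      · obtain ⟨h₁, h₂, h₃, h₄, h₅⟩ := hmem q hq
        exact ⟨h₁, by omega, h₃, by omega, h₅⟩
      · obtain rfl : q = (n + 2, n + 2) := by simpa using hq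
        simp

theorem Finset.sum_le_sum_list_map {α : Type*} (s : Finset α) (l : List α) (f : α → ℝ)
    (hf : ∀ x, 0 ≤ f x) (hs : ∀ x ∈ s, x ∈ l) : ∑ x ∈ s, f x ≤ (l.map f).sum := by
  classical
  rw [Finset.sum_list_map_count]
  calc ∑ x ∈ s, f x ≤ ∑ x ∈ l.toFinset, f x :=
        Finset.sum_le_sum_of_subset_of_nonneg (fun x hx => List.mem_toFinset.2 (hs x hx))
          fun x _ _ => hf x
    _ ≤ ∑ x ∈ l.toFinset, l.count x • f x := by
        refine Finset.sum_le_sum fun x hx => ?_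
        have hc : 1 ≤ l.count x := List.count_pos_iff.2 (List.mem_toFinset.1 hx)
        simpa using nsmul_le_nsmul_left (hf x) hc

/-- If a path visits a point `(i, j i)` for each `i ∈ s`, those points cost at most the path. -/
theorem sum_delta_le_pathCost (A B : ℕ → ℝ) (p : List (ℕ × ℕ)) (s : Finset ℕ) (j : ℕ → ℕ)
    (hj : ∀ i ∈ s, (i, j i) ∈ p) : ∑ i ∈ s, delta (A i) (B (j i)) ≤ pathCost A B p := by
  have h := Finset.sum_le_sum_list_map (s.image fun i => (i, j i)) p
    (fun q => delta (A q.1) (B q.2)) (fun _ => delta_nonneg _ _) (by simpa using hj)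
  rwa [Finset.sum_image (fun x _ y _ hxy => (Prod.mk.inj hxy).1)] at h

/-- LB_New is a lower bound on `DTW²_W(A,B)`. -/
theorem lbNew_lower_bound (L W : ℕ) (hL : 2 ≤ L) (A B : ℕ → ℝ) :
    delta (A 1) (B 1) + delta (A L) (B L) +
      ∑ i ∈ Finset.Icc 2 (L - 1),
        sInf ((fun j => delta (A i) (B j)) '' Set.Icc (max 1 (i - W)) (min L (i + W))) ≤
    DTW2 L W A B := by
  refine le_csInf ?_ ?_
  · obtain ⟨p, hp⟩ := exists_isWarpingPath W (L - 1)
    rw [Nat.sub_add_cancel (by omega)] at hp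
    exact ⟨_, p, hp, rfl⟩
  rintro _ ⟨p, ⟨hhead, hlast, hchain, hmem⟩, rfl⟩
  have hfst : (1, 1) ∈ p := List.mem_of_head? hhead
  have hlst : (L, L) ∈ p := List.mem_of_getLast? hlast
  have hex : ∀ i, ∃ k, i ∈ Finset.Icc 2 (L - 1) → (i, k) ∈ p := by
    intro i
    by_cases hi : i ∈ Finset.Icc 2 (L - 1)
    · obtain ⟨l, rfl⟩ : ∃ l, p = (1, 1) :: l := List.head?_eq_some_iff.1 hhead
      rw [Finset.mem_Icc] at hi
      obtain ⟨⟨_, k⟩, hq, rfl⟩ :=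
        exists_mem_fst_eq_of_isChain_step l _ _ hchain hlast i (by simp only; omega)
          (by simp only; omega)
      exact ⟨k, fun _ => hq⟩
    · exact ⟨0, fun h => absurd h hi⟩
  choose k hk using hex
  set j : ℕ → ℕ := fun i => if i = 1 then 1 else if i = L then L else k i with hjdef
  have hj1 : j 1 = 1 := by simp [hjdef]
  have hjL : j L = L := by simp [hjdef, eq_comm]
  have hjk : ∀ i ∈ Finset.Icc 2 (L - 1), j i = k i := by
    intro i hi
    rw [Finset.mem_Icc] at hi
    simp only [hjdef]
    rw [if_neg (by omega), if_neg (by omega)]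
  have hsum := sum_delta_le_pathCost A B p (insert 1 (insert L (Finset.Icc 2 (L - 1)))) j (by
    intro i hi
    rcases Finset.mem_insert.1 hi with rfl | hi
    · rwa [hj1]
    rcases Finset.mem_insert.1 hi with rfl | hi
    · rwa [hjL]
    · rw [hjk i hi]
      exact hk i hi)
  rw [Finset.sum_insert (by simp; omega), Finset.sum_insert (by simp; omega), hj1, hjL,
    ← add_assoc] at hsum
  refine le_trans (add_le_add_right (Finset.sum_le_sum fun i hi => ?_) _) hsum
  refine csInf_le ⟨0, ?_⟩ ⟨j i, ?_, rfl⟩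
  · rintro _ ⟨m, _, rfl⟩
    exact delta_nonneg _ _
  · obtain ⟨h₁, h₂, h₃, h₄, h₅⟩ := hmem _ (hk i hi)
    rw [hjk i hi]
    simp only at h₁ h₂ h₃ h₄ h₅
    simp only [Set.mem_Icc, max_le_iff, le_min_iff]
    omega
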